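/- arXiv:2504.10478 — 6 statements merged into one kernel-verified Lean document; each statement's English description precedes it below -/
import Mathlib

section
/- Let (Ω, F, P) be a probability space and ρ : Ω → ℝ a random variable with 0 ≤ ρ ≤ 1 almost surely. For every integer k ≥ 2, E[1 − (1 − ρ)^k] ≤ 1 − ((E[1 − ρ])² + Var(ρ))^{k/2}. -/
open MeasureTheory ProbabilityTheory

/-- **Power mean inequality**: for a nonnegative `X` on a probability space and `k ≥ 2`,
the second moment to the power `k / 2` is at most the `k`-th moment. -/
theorem rpow_second_moment_le_moment
    {Ω : Type*} [MeasurableSpace Ω] {μ : Measure Ω} [IsProbabilityMeasure μ]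
    {X : Ω → ℝ} (hX : 0 ≤ᵐ[μ] X) {k : ℕ} (hk : 2 ≤ k)
    (h2 : Integrable (fun ω ↦ X ω ^ 2) μ) (hint : Integrable (fun ω ↦ X ω ^ k) μ) :
    (∫ ω, X ω ^ 2 ∂μ) ^ ((k : ℝ) / 2) ≤ ∫ ω, X ω ^ k ∂μ := by
  have hk' : (1 : ℝ) ≤ (k : ℝ) / 2 := by
    rw [le_div_iff₀ two_pos]
    exact_mod_cast (by simpa using hk)
  have hpow : (fun ω ↦ (X ω ^ 2) ^ ((k : ℝ) / 2)) =ᵐ[μ] fun ω ↦ X ω ^ k := by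
    filter_upwards [hX] with ω hω
    rw [← Real.rpow_natCast_mul hω, Nat.cast_ofNat, mul_div_cancel₀ _ two_ne_zero,
      Real.rpow_natCast]
  rw [← integral_congr_ae hpow]
  exact (convexOn_rpow hk').map_integral_le
    (Real.continuous_rpow_const (by positivity)).continuousOn isClosed_Ici
    (.of_forall fun ω ↦ sq_nonneg (X ω)) h2 (hint.congr hpow.symm)

/-- **Proposition 1 (bias–variance upper bound on expected Pass@k).**
If `ρ` is a random variable on a probability space with `0 ≤ ρ ≤ 1` almost surely,
then for every integer `k ≥ 2`,
`E[1 − (1 − ρ)^k] ≤ 1 − ((E[1 − ρ])² + Var(ρ))^(k/2)`. -/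
theorem expected_passk_bias_variance_bound
    {Ω : Type*} [MeasurableSpace Ω] (μ : Measure Ω) [IsProbabilityMeasure μ]
    (ρ : Ω → ℝ) (hmeas : Measurable ρ)
    (hbdd : ∀ᵐ ω ∂μ, 0 ≤ ρ ω ∧ ρ ω ≤ 1)
    (k : ℕ) (hk : 2 ≤ k) :
    ∫ ω, (1 - (1 - ρ ω) ^ k) ∂μ ≤
      1 - ((∫ ω, (1 - ρ ω) ∂μ) ^ 2 + variance ρ μ) ^ ((k : ℝ) / 2) := by
  have hX : ∀ᵐ ω ∂μ, 1 - ρ ω ∈ Set.Icc (0 : ℝ) 1 := by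
    filter_upwards [hbdd] with ω ⟨h0, h1⟩
    exact ⟨by linarith, by linarith⟩
  have hXm : AEStronglyMeasurable (fun ω ↦ 1 - ρ ω) μ := by fun_prop
  have hint (n : ℕ) : Integrable (fun ω ↦ (1 - ρ ω) ^ n) μ := by
    refine .of_mem_Icc 0 1 (by fun_prop) ?_
    filter_upwards [hX] with ω ⟨h0, h1⟩
    exact ⟨pow_nonneg h0 n, pow_le_one₀ h0 h1⟩
  have hvar : (∫ ω, (1 - ρ ω) ∂μ) ^ 2 + variance ρ μ = ∫ ω, (1 - ρ ω) ^ 2 ∂μ := by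
    rw [← variance_const_sub hmeas.aestronglyMeasurable 1,
      variance_eq_sub (memLp_of_bounded hX hXm 2)]
    simp only [Pi.pow_apply, add_sub_cancel]
  rw [hvar, integral_sub (integrable_const 1) (hint k), integral_const, probReal_univ, one_smul]
  exact sub_le_sub_left
    (rpow_second_moment_le_moment (hX.mono fun _ h ↦ h.1) hk (hint 2) (hint k)) 1
end

section
/- Let K ≥ 1, η > 0, and let θ : ℕ → (Fin (K+1) → ℝ) be a sequence of parameter vectors with associated probabilities p^{(t)}_i = softmax(θ^{(t)})_i. Suppose for every t: (i) ∑_{i} θ^{(t)}_i = 0, and (ii) θ^{(t+1)}_{K+1} = θ^{(t)}_{K+1} − η · p^{(t)}_{K+1}. Then p^{(t)}_{K+1} → 0 as t → ∞. -/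
open Filter

/-- The softmax distribution associated to a parameter vector `θ`. -/
noncomputable def softmax {n : ℕ} (θ : Fin n → ℝ) (i : Fin n) : ℝ :=
  Real.exp (θ i) / ∑ j, Real.exp (θ j)

lemma softmax_nonneg {n : ℕ} (θ : Fin n → ℝ) (i : Fin n) : 0 ≤ softmax θ i := by
  unfold softmax
  positivity

/-- For a centred parameter vector the softmax normalizer is at least `1`. -/
lemma one_le_sum_exp_of_sum_eq_zero {n : ℕ} (θ : Fin (n + 1) → ℝ) (h : ∑ i, θ i = 0) :
    1 ≤ ∑ i, Real.exp (θ i) :=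
  calc (1 : ℝ) ≤ ∑ i, (θ i + 1) := by simp [Finset.sum_add_distrib, h]
    _ ≤ ∑ i, Real.exp (θ i) := Finset.sum_le_sum fun i _ => Real.add_one_le_exp (θ i)

lemma softmax_le_exp_of_sum_eq_zero {n : ℕ} (θ : Fin (n + 1) → ℝ) (h : ∑ i, θ i = 0)
    (i : Fin (n + 1)) : softmax θ i ≤ Real.exp (θ i) :=
  div_le_self (Real.exp_pos _).le (one_le_sum_exp_of_sum_eq_zero θ h)

/-- **Bad arm probability diminishes (deterministic core of the REINFORCE lemma).**
If the coordinate sum of `θ^(t)` is always `0` and the bad-arm parameter (index `K+1`,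
i.e. `Fin.last K`) satisfies the recursion `θ^(t+1) = θ^(t) − η · p^(t)` where
`p^(t) = softmax (θ^(t))`, then the bad-arm probability tends to `0`. -/
theorem bad_arm_probability_diminishes
    (K : ℕ) (hK : 1 ≤ K) (η : ℝ) (hη : 0 < η)
    (θ : ℕ → Fin (K + 1) → ℝ)
    (hsum : ∀ t, ∑ i, θ t i = 0)
    (hrec : ∀ t, θ (t + 1) (Fin.last K) =
      θ t (Fin.last K) - η * softmax (θ t) (Fin.last K)) :
    Tendsto (fun t => softmax (θ t) (Fin.last K)) atTop (nhds 0) := by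
  have hanti : Antitone fun t => θ t (Fin.last K) := antitone_nat_of_succ_le fun t => by
    rw [hrec t]
    exact sub_le_self _ (mul_nonneg hη.le (softmax_nonneg _ _))
  rcases tendsto_atTop_of_antitone hanti with hbot | ⟨l, hl⟩
  · exact squeeze_zero (fun t => softmax_nonneg _ _)
      (fun t => softmax_le_exp_of_sum_eq_zero _ (hsum t) _) (Real.tendsto_exp_atBot.comp hbot)
  · have hdiff := (hl.sub (hl.comp (tendsto_add_atTop_nat 1))).div_const η
    rw [sub_self, zero_div] at hdiff
    refine hdiff.congr fun t => ?_
    simp only [Function.comp_apply, hrec t]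
    field_simp
    ring
end

section
/- Let K ≥ 1, β > 0, and let p0 : Fin (K+1) → ℝ be a strictly positive probability vector. Define rewards r_i = 1 for i ≤ K and r_{K+1} = 0, and the objective J(θ) = ∑_{i=1}^{K+1} r_i · softmax(θ)_i − β ∑_{i=1}^{K+1} softmax(θ)_i · log(softmax(θ)_i / p0_i) for θ : Fin (K+1) → ℝ. If θ* is a critical point of J (all partial derivatives of J vanish at θ*) and p*_i = softmax(θ*)_i, then for all i, j ∈ {1,…,K}: p*_i / p*_j = p0_i / p0_j; equivalently p*_i / ∑_{l=1}^{K} p*_l = p0_i / ∑_{l=1}^{K} p0_l for all i ≤ K. -/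
open Finset

theorem softmax_pos {n : ℕ} (θ : Fin n → ℝ) (i : Fin n) : 0 < softmax θ i :=
  div_pos (Real.exp_pos _) (sum_pos (fun _ _ => Real.exp_pos _) ⟨i, mem_univ i⟩)

/-- The partial derivatives of softmax are `∂ₖ softmaxᵢ = softmaxᵢ * (δᵢₖ - softmaxₖ)`. -/
theorem hasDerivAt_softmax_update {n : ℕ} (θ : Fin n → ℝ) (k i : Fin n) :
    HasDerivAt (fun s : ℝ => softmax (Function.update θ k s) i)
      (softmax θ i * ((if i = k then 1 else 0) - softmax θ k)) (θ k) := by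
  have hexp : ∀ j, HasDerivAt (fun s : ℝ => Real.exp (Function.update θ k s j))
      (if j = k then Real.exp (θ k) else 0) (θ k) := by
    intro j
    by_cases hj : j = k
    · subst hj
      simpa using Real.hasDerivAt_exp (θ j)
    · simpa [hj] using hasDerivAt_const (θ k) (Real.exp (θ j))
  have hsum : HasDerivAt (fun s : ℝ => ∑ j, Real.exp (Function.update θ k s j))
      (Real.exp (θ k)) (θ k) := by
    simpa using HasDerivAt.fun_sum fun j (_ : j ∈ univ) => hexp j
  have hZ : ∑ j, Real.exp (θ j) ≠ 0 :=
    (sum_pos (fun _ _ => Real.exp_pos _) ⟨k, mem_univ k⟩).ne'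
  have h := (hexp i).fun_div hsum (by simpa using hZ)
  simp only [Function.update_eq_self] at h
  refine h.congr_deriv ?_
  unfold softmax
  by_cases hi : i = k
  · subst hi
    simp only [if_true]
    field_simp
  · simp only [hi, if_false]
    field_simp
    ring

/-- At a critical point of `θ ↦ ∑ i, f i (softmax θ i)` the derivatives of the `f i` all agree. -/
theorem deriv_eq_of_softmax_critical {n : ℕ} {f : Fin n → ℝ → ℝ} {g : Fin n → ℝ}
    {θ : Fin n → ℝ} (hf : ∀ i, HasDerivAt (f i) (g i) (softmax θ i))
    (hcrit : ∀ k, HasDerivAt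
      (fun s : ℝ => ∑ i, f i (softmax (Function.update θ k s) i)) 0 (θ k))
    (k l : Fin n) : g k = g l := by
  suffices h : ∀ k, g k = ∑ i, g i * softmax θ i from (h k).trans (h l).symm
  intro k
  have hd : HasDerivAt (fun s : ℝ => ∑ i, f i (softmax (Function.update θ k s) i))
      (∑ i, g i * (softmax θ i * ((if i = k then 1 else 0) - softmax θ k))) (θ k) := by
    refine HasDerivAt.fun_sum fun i _ => ?_
    refine HasDerivAt.comp (h₂ := f i) (θ k) ?_ (hasDerivAt_softmax_update θ k i)
    simpa using hf i
  have h0 := hd.unique (hcrit k)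
  have hfactor : ∑ i, g i * (softmax θ i * ((if i = k then 1 else 0) - softmax θ k)) =
      softmax θ k * (g k - ∑ i, g i * softmax θ i) := by
    simp only [mul_sub, sum_sub_distrib, mul_ite, mul_one, mul_zero, sum_ite_eq', mem_univ,
      if_true, mul_sum]
    congr 1
    · ring
    · exact sum_congr rfl fun i _ => by ring
  rw [hfactor] at h0
  exact sub_eq_zero.mp ((mul_eq_zero.mp h0).resolve_left (softmax_pos θ k).ne')

theorem hasDerivAt_mul_log_div {q x : ℝ} (hq : q ≠ 0) (hx : x ≠ 0) :
    HasDerivAt (fun y : ℝ => y * Real.log (y / q)) (Real.log (x / q) + 1) x := by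
  have h := (hasDerivAt_id x).fun_mul
    (((hasDerivAt_id x).div_const q).log (div_ne_zero hx hq))
  refine h.congr_deriv ?_
  simp only [id]
  field_simp

/-- **Diversity preservation under KL regularization.**
In the `(K+1)`-armed bandit with good arms (reward `1`) the first `K` indices and the bad
arm (reward `0`) the last index, consider the KL-regularized objective
`J(θ) = ∑ i, r i · softmax θ i − β ∑ i, softmax θ i · log (softmax θ i / p0 i)`.
If all partial derivatives of `J` vanish at `θ*` and `p* = softmax θ*`, then for all good
arms `i, j`: `p*_i / p*_j = p0_i / p0_j`; equivalently, `p*` restricted to the good arms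
and renormalized coincides with `p0` restricted to the good arms and renormalized. -/
theorem diversity_preservation_under_KL
    (K : ℕ) (hK : 1 ≤ K) (β : ℝ) (hβ : 0 < β)
    (p0 : Fin (K + 1) → ℝ) (hp0pos : ∀ i, 0 < p0 i) (hp0sum : ∑ i, p0 i = 1)
    (r : Fin (K + 1) → ℝ) (hr : ∀ i, r i = if i = Fin.last K then (0 : ℝ) else 1)
    (J : (Fin (K + 1) → ℝ) → ℝ)
    (hJ : ∀ θ, J θ = ∑ i, r i * softmax θ i -
      β * ∑ i, softmax θ i * Real.log (softmax θ i / p0 i))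
    (θs : Fin (K + 1) → ℝ)
    (hcrit : ∀ k, HasDerivAt (fun s : ℝ => J (Function.update θs k s)) 0 (θs k)) :
    (∀ i j : Fin (K + 1), i ≠ Fin.last K → j ≠ Fin.last K →
      softmax θs i / softmax θs j = p0 i / p0 j) ∧
    (∀ i : Fin (K + 1), i ≠ Fin.last K →
      softmax θs i / ∑ l ∈ univ.filter (fun l => l ≠ Fin.last K), softmax θs l =
        p0 i / ∑ l ∈ univ.filter (fun l => l ≠ Fin.last K), p0 l) := by
  have hderiv : ∀ i, HasDerivAt (fun y : ℝ => r i * y - β * (y * Real.log (y / p0 i)))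
      (r i - β * (Real.log (softmax θs i / p0 i) + 1)) (softmax θs i) := fun i => by
    simpa using ((hasDerivAt_id (softmax θs i)).const_mul (r i)).fun_sub
      ((hasDerivAt_mul_log_div (hp0pos i).ne' (softmax_pos θs i).ne').const_mul β)
  have hJ' : ∀ θ, J θ =
      ∑ i, (r i * softmax θ i - β * (softmax θ i * Real.log (softmax θ i / p0 i))) :=
    fun θ => by rw [hJ, sum_sub_distrib, mul_sum]
  simp only [hJ'] at hcrit
  have hcross : ∀ i j : Fin (K + 1), i ≠ Fin.last K → j ≠ Fin.last K →
      softmax θs i * p0 j = p0 i * softmax θs j := by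
    intro i j hi hj
    have h := deriv_eq_of_softmax_critical hderiv hcrit i j
    rw [hr, hr, if_neg hi, if_neg hj] at h
    have hlog : Real.log (softmax θs i / p0 i) = Real.log (softmax θs j / p0 j) := by
      have := mul_left_cancel₀ hβ.ne' (sub_right_injective h)
      linarith
    have hratio := Real.log_injOn_pos (div_pos (softmax_pos θs i) (hp0pos i))
      (div_pos (softmax_pos θs j) (hp0pos j)) hlog
    rw [div_eq_div_iff (hp0pos i).ne' (hp0pos j).ne'] at hratio
    linarith
  refine ⟨fun i j hi hj => ?_, fun i hi => ?_⟩
  · rw [div_eq_div_iff (softmax_pos θs j).ne' (hp0pos j).ne']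
    exact hcross i j hi hj
  · have hne : (univ.filter fun l => l ≠ Fin.last K).Nonempty := ⟨i, by simpa using hi⟩
    rw [div_eq_div_iff (sum_pos (fun l _ => softmax_pos θs l) hne).ne'
      (sum_pos (fun l _ => hp0pos l) hne).ne', mul_sum, mul_sum]
    exact sum_congr rfl fun l hl => hcross i l hi (mem_filter.mp hl).2
end

section
/- Let K ≥ 1, ε > 0, and let p be a probability vector on Fin (K+1) with rewards r_i = 1 for i ≤ K and r_{K+1} = 0. Let i* ≤ K satisfy p_{i*} = max_{i ≤ K} p_i, and assume 1/(2K) ≤ p_{i*} ≤ 1 − ε. Let I be a random arm with P(I = j) = p_j, and for a good arm i ≤ K with i ≠ i* define Δ = r_I · ( 𝟙(I = i) − 𝟙(I = i*) − p_i + p_{i*} ). Then E[Δ²] ≥ p_{i*}(1 − p_{i*})² ≥ ε²/(2K). -/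
/-- **Second-moment lower bound for REINFORCE updates (self-enforcing stochastic).**
In the `(K+1)`-armed bandit with good arms (the first `K` indices, reward `1`) and bad arm
(the last index, reward `0`), let `i*` be a good arm of maximal probability with
`1/(2K) ≤ p_{i*} ≤ 1 − ε`, and let `i ≠ i*` be another good arm. For the difference of
single-step REINFORCE updates `Δ = r_I (𝟙(I = i) − 𝟙(I = i*) − p_i + p_{i*})`, where the
random arm `I` has law `p`, we have `E[Δ²] ≥ p_{i*}(1 − p_{i*})² ≥ ε²/(2K)`; the
expectation over the finitely supported law of `I` is written as the explicit sum. -/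
theorem reinforce_second_moment_lower_bound
    (K : ℕ) (hK : 1 ≤ K) (ε : ℝ) (hε : 0 < ε)
    (p : Fin (K + 1) → ℝ) (hp : ∀ j, 0 ≤ p j) (hps : ∑ j, p j = 1)
    (r : Fin (K + 1) → ℝ) (hr : ∀ j, r j = if j = Fin.last K then (0 : ℝ) else 1)
    (istar : Fin (K + 1)) (histar : istar ≠ Fin.last K)
    (hmax : ∀ j : Fin (K + 1), j ≠ Fin.last K → p j ≤ p istar)
    (hlb : 1 / (2 * (K : ℝ)) ≤ p istar) (hub : p istar ≤ 1 - ε)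
    (i : Fin (K + 1)) (hi : i ≠ Fin.last K) (hii : i ≠ istar) :
    p istar * (1 - p istar) ^ 2 ≤
      ∑ l, p l * (r l * ((if l = i then (1 : ℝ) else 0) -
        (if l = istar then (1 : ℝ) else 0) - p i + p istar)) ^ 2 ∧
    ε ^ 2 / (2 * (K : ℝ)) ≤ p istar * (1 - p istar) ^ 2 := by
  have hstar : p istar * (r istar * ((if istar = i then (1 : ℝ) else 0) -
      (if istar = istar then (1 : ℝ) else 0) - p i + p istar)) ^ 2 =
      p istar * (1 - p istar + p i) ^ 2 := by
    rw [hr, if_neg histar, if_neg hii.symm, if_pos rfl]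
    ring
  constructor
  · calc p istar * (1 - p istar) ^ 2
        ≤ p istar * (1 - p istar + p i) ^ 2 :=
          mul_le_mul_of_nonneg_left
            (pow_le_pow_left₀ (by linarith) (by linarith [hp i]) 2) (hp istar)
      _ ≤ _ := by
          rw [← hstar]
          exact Finset.single_le_sum
            (f := fun l => p l * (r l * ((if l = i then (1 : ℝ) else 0) -
              (if l = istar then (1 : ℝ) else 0) - p i + p istar)) ^ 2)
            (fun l _ => mul_nonneg (hp l) (sq_nonneg _)) (Finset.mem_univ istar)
  · calc ε ^ 2 / (2 * (K : ℝ)) = 1 / (2 * (K : ℝ)) * ε ^ 2 := by ring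
      _ ≤ p istar * (1 - p istar) ^ 2 :=
          mul_le_mul hlb (pow_le_pow_left₀ hε.le (by linarith) 2) (sq_nonneg ε) (hp istar)
end

section
/- Let C > 0 and set A_C = (exp(−C) + C − 1)/C². Then for every real x with 0 < |x| < C: exp(x) > 1 + x + A_C · x². -/
theorem two_sub_mul_exp_lt {y : ℝ} (hy : 0 < y) : (2 - y) * Real.exp y < 2 + y := by
  have hd : ∀ t : ℝ, HasDerivAt (fun t => (t - 2) * Real.exp t + t)
      (1 * Real.exp t + (t - 2) * Real.exp t + 1) t := fun t =>
    (((hasDerivAt_id t).sub_const 2).mul (Real.hasDerivAt_exp t)).add (hasDerivAt_id t)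
  have hmono : StrictMonoOn (fun t : ℝ => (t - 2) * Real.exp t + t) (Set.Ici 0) := by
    refine strictMonoOn_of_deriv_pos (convex_Ici 0)
      (fun t _ => (hd t).continuousAt.continuousWithinAt) fun t ht => ?_
    rw [interior_Ici, Set.mem_Ioi] at ht
    rw [(hd t).deriv]
    have h1 : -t + 1 < Real.exp (-t) := Real.add_one_lt_exp (by linarith)
    have h2 : Real.exp t * Real.exp (-t) = 1 := by rw [← Real.exp_add]; simp
    nlinarith [mul_lt_mul_of_pos_left h1 (Real.exp_pos t)]
  have h := hmono Set.self_mem_Ici hy.le hy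
  simp only [Real.exp_zero] at h
  linarith

theorem strictAntiOn_exp_neg_add_sub_one_div_sq :
    StrictAntiOn (fun y : ℝ => (Real.exp (-y) + y - 1) / y ^ 2) (Set.Ioi 0) := by
  have hd : ∀ t ∈ Set.Ioi (0 : ℝ), HasDerivAt (fun y : ℝ => (Real.exp (-y) + y - 1) / y ^ 2)
      (((Real.exp (-t) * (-1) + 1) * t ^ 2 - (Real.exp (-t) + t - 1) * (2 * t)) / (t ^ 2) ^ 2)
      t := fun t ht => by
    have hsq : HasDerivAt (fun y : ℝ => y ^ 2) (2 * t) t := by simpa using hasDerivAt_pow 2 t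
    exact (((hasDerivAt_neg t).exp.add (hasDerivAt_id t)).sub_const 1).div hsq
      (pow_ne_zero 2 (ne_of_gt ht))
  refine strictAntiOn_of_deriv_neg (convex_Ioi 0)
    (fun t ht => (hd t ht).continuousAt.continuousWithinAt) fun t ht => ?_
  rw [interior_Ioi] at ht
  rw [(hd t ht).deriv]
  have ht0 : 0 < t := ht
  refine div_neg_of_neg_of_pos ?_ (by positivity)
  have h1 := mul_lt_mul_of_pos_left (two_sub_mul_exp_lt ht0) (Real.exp_pos (-t))
  have h2 : Real.exp (-t) * Real.exp t = 1 := by rw [← Real.exp_add]; simp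
  have h3 : 2 - t < Real.exp (-t) * (2 + t) := by
    linear_combination h1 - (2 - t) * h2
  linear_combination t * h3

theorem exp_neg_lt_quadratic {y : ℝ} (hy : 0 < y) : Real.exp (-y) < 1 - y + y ^ 2 / 2 := by
  have h1 := Real.quadratic_le_exp_of_nonneg hy.le
  rw [Real.exp_neg, inv_lt_iff_one_lt_mul₀ (Real.exp_pos y)]
  have h2 : 0 < 1 - y + y ^ 2 / 2 := by nlinarith [sq_nonneg (y - 1)]
  nlinarith [mul_le_mul_of_nonneg_left h1 h2.le, pow_pos hy 4]

/-- **Technical exponential lower bound (Lemma `exp-bound`).**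
For `C > 0` and `A_C = (exp(−C) + C − 1)/C²`, every real `x` with `0 < |x| < C`
satisfies `exp x > 1 + x + A_C x²`. -/
theorem exp_bound (C : ℝ) (hC : 0 < C) (A : ℝ) (hA : A = (Real.exp (-C) + C - 1) / C ^ 2)
    (x : ℝ) (hx0 : 0 < |x|) (hxC : |x| < C) :
    1 + x + A * x ^ 2 < Real.exp x := by
  subst hA
  rcases lt_or_gt_of_ne (abs_pos.mp hx0) with hx | hx
  · rw [abs_of_neg hx] at hxC
    have h := strictAntiOn_exp_neg_add_sub_one_div_sq (neg_pos.mpr hx) hC hxC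
    simp only [neg_neg, neg_sq] at h
    rw [lt_div_iff₀ (sq_pos_of_neg hx)] at h
    linarith
  · have hA : (Real.exp (-C) + C - 1) / C ^ 2 < 1 / 2 := by
      rw [div_lt_iff₀ (by positivity)]
      linarith [exp_neg_lt_quadratic hC]
    have h := mul_lt_mul_of_pos_right hA (pow_pos hx 2)
    linarith [Real.quadratic_le_exp_of_nonneg hx.le]
end

section
/- The function g : ℝ \ {0} → ℝ defined by g(x) = (exp(x) − 1 − x)/x² is strictly increasing: for all nonzero reals x < y, g(x) < g(y). -/
theorem strictMono_of_hasDerivAt_pos_of_ne {f f' : ℝ → ℝ} (a : ℝ)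
    (hf : ∀ x, HasDerivAt f (f' x) x) (hpos : ∀ x, x ≠ a → 0 < f' x) : StrictMono f := by
  have hc : Continuous f := continuous_iff_continuousAt.2 fun x => (hf x).continuousAt
  refine StrictMonoOn.Iic_union_Ici (a := a)
    (strictMonoOn_of_deriv_pos (convex_Iic a) hc.continuousOn fun x hx => ?_)
    (strictMonoOn_of_deriv_pos (convex_Ici a) hc.continuousOn fun x hx => ?_)
  · rw [interior_Iic] at hx
    exact (hf x).deriv ▸ hpos x (ne_of_lt hx)
  · rw [interior_Ici] at hx
    exact (hf x).deriv ▸ hpos x (ne_of_gt hx)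

theorem strictMono_exp_sub_quadratic :
    StrictMono fun x : ℝ => Real.exp x - 1 - x - x ^ 2 / 2 := by
  refine strictMono_of_hasDerivAt_pos_of_ne (f' := fun x => Real.exp x - 1 - x) 0
    (fun x => ?_) fun x hx => by linarith [Real.add_one_lt_exp hx]
  refine HasDerivAt.congr_deriv ((((Real.hasDerivAt_exp x).sub_const 1).sub
    (hasDerivAt_id x)).sub (((hasDerivAt_id x).pow 2).div_const 2)) ?_
  simp

theorem strictMono_sub_two_mul_exp_add :
    StrictMono fun x : ℝ => (x - 2) * Real.exp x + x + 2 := by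
  refine strictMono_of_hasDerivAt_pos_of_ne (f' := fun x => (x - 1) * Real.exp x + 1) 0
    (fun x => ?_) fun x hx => ?_
  · refine HasDerivAt.congr_deriv (((((hasDerivAt_id x).sub_const 2).mul
      (Real.hasDerivAt_exp x)).add (hasDerivAt_id x)).add_const 2) ?_
    simp only [id]
    ring
  · have h := mul_lt_mul_of_pos_right (Real.add_one_lt_exp (neg_ne_zero.2 hx)) (Real.exp_pos x)
    rw [← Real.exp_add, neg_add_cancel, Real.exp_zero] at h
    linarith

theorem hasDerivAt_exp_sub_one_sub_div_sq {x : ℝ} (hx : x ≠ 0) :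
    HasDerivAt (fun x : ℝ => (Real.exp x - 1 - x) / x ^ 2)
      (((x - 2) * Real.exp x + x + 2) / x ^ 3) x := by
  refine HasDerivAt.congr_deriv ((((Real.hasDerivAt_exp x).sub_const 1).sub
    (hasDerivAt_id x)).div ((hasDerivAt_id x).pow 2) (pow_ne_zero 2 hx)) ?_
  simp only [id, Pi.sub_apply]
  field_simp
  ring

theorem deriv_exp_sub_one_sub_div_sq_pos {x : ℝ} (hx : x ≠ 0) :
    0 < deriv (fun x : ℝ => (Real.exp x - 1 - x) / x ^ 2) x := by
  rw [(hasDerivAt_exp_sub_one_sub_div_sq hx).deriv]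
  rcases hx.lt_or_gt with h | h
  · have := strictMono_sub_two_mul_exp_add h
    norm_num at this
    exact div_pos_of_neg_of_neg this (Odd.pow_neg (by decide) h)
  · have := strictMono_sub_two_mul_exp_add h
    norm_num at this
    exact div_pos this (pow_pos h 3)

/-- **Strict monotonicity of `g(x) = (exp x − 1 − x)/x²` on the nonzero reals.**
For all nonzero reals `x < y`, `g x < g y`. -/
theorem exp_ratio_strictMono (x y : ℝ) (hx : x ≠ 0) (hy : y ≠ 0) (hxy : x < y) :
    (Real.exp x - 1 - x) / x ^ 2 < (Real.exp y - 1 - y) / y ^ 2 := by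
  have hmono {s : Set ℝ} (hs : Convex ℝ s) (h0 : ∀ z ∈ s, z ≠ 0) :
      StrictMonoOn (fun x : ℝ => (Real.exp x - 1 - x) / x ^ 2) s :=
    strictMonoOn_of_deriv_pos hs
      (fun z hz => (hasDerivAt_exp_sub_one_sub_div_sq (h0 z hz)).continuousAt.continuousWithinAt)
      fun z hz => deriv_exp_sub_one_sub_div_sq_pos (h0 z (interior_subset hz))
  rcases hx.lt_or_gt with hx0 | hx0
  · rcases hy.lt_or_gt with hy0 | hy0
    · exact hmono (convex_Iio 0) (fun z hz => ne_of_lt hz) hx0 hy0 hxy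
    · have h1 := strictMono_exp_sub_quadratic hx0
      have h2 := strictMono_exp_sub_quadratic hy0
      norm_num at h1 h2
      calc (Real.exp x - 1 - x) / x ^ 2 < 1 / 2 := by
            rw [div_lt_iff₀ (by positivity)]; linarith
        _ < (Real.exp y - 1 - y) / y ^ 2 := by
            rw [lt_div_iff₀ (by positivity)]; linarith
  · exact hmono (convex_Ioi 0) (fun z hz => ne_of_gt hz) hx0 (hx0.trans hxy) hxy
end
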